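/- Let f ∈ ℂ[X] be monic of degree m ≥ 1, let g_0,…,g_{m−1} ∈ ℂ[X], and set g(X) = ∑_{k=0}^{m−1} X^k · g_k(f(X)). Let s_k = ∑_{z ∈ roots(f)} z^k (with multiplicity) for 0 ≤ k ≤ m−1. Then the following are equivalent: (a) for every t ∈ ℂ, ∑_{z ∈ roots(f−t), with multiplicity} g(z) = 0; (b) ∑_{k=0}^{m−1} s_k · g_k = 0 in ℂ[X]. (This is the Newton–Girard criterion: the sum of g over every fiber of f vanishes if and only if the coefficient vector (g_0,…,g_{m−1}) is orthogonal to the Newton–Girard vector s(f) = (s_0,…,s_{m−1}).) -/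

import Mathlib

open Polynomial

/-- Power sums of degree at most `n` are determined by the elementary symmetric functions of degree
at most `n`. -/
theorem MvPolynomial.aeval_psum_eq_of_aeval_esymm_eq {σ R S : Type*} [Fintype σ] [CommRing R]
    [CommRing S] [Algebra R S] (a b : σ → S) (n : ℕ)
    (h : ∀ j ≤ n, aeval a (esymm σ R j) = aeval b (esymm σ R j)) :
    ∀ k ≤ n, aeval a (psum σ R k) = aeval b (psum σ R k) := by
  intro k
  induction k using Nat.strong_induction_on with
  | _ k ih =>
    intro hk
    rcases Nat.eq_zero_or_pos k with rfl | hpos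
    · simp [psum]
    · rw [psum_eq_mul_esymm_sub_sum σ R k hpos]
      simp only [map_sub, map_mul, map_pow, map_neg, map_one, map_natCast, map_sum, h k hk]
      congr 1
      refine Finset.sum_congr rfl fun x hx => ?_
      simp only [Finset.mem_filter, Finset.HasAntidiagonal.mem_antidiagonal, Set.mem_Ioo] at hx
      rw [h x.1 (by omega), ih x.2 (by omega) (by omega)]

theorem Multiset.exists_map_univ_eq {α : Type*} {n : ℕ} (s : Multiset α) (hs : s.card = n) :
    ∃ a : Fin n → α, (Finset.univ : Finset (Fin n)).val.map a = s := by
  subst hs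
  refine ⟨fun i => s.toList.get (i.cast s.length_toList.symm), ?_⟩
  rw [Fin.univ_val_map]
  refine Eq.trans ?_ s.coe_toList
  exact congrArg _ (List.ext_get (by simp) (by simp))

theorem Multiset.sum_map_pow_eq_of_esymm_eq {R : Type*} [CommRing R] {s t : Multiset R}
    (hcard : s.card = t.card) (n : ℕ) (h : ∀ j ≤ n, s.esymm j = t.esymm j) (k : ℕ) (hk : k ≤ n) :
    (s.map fun z => z ^ k).sum = (t.map fun z => z ^ k).sum := by
  obtain ⟨m, hm⟩ : ∃ m, t.card = m := ⟨_, rfl⟩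
  obtain ⟨a, rfl⟩ := s.exists_map_univ_eq (hcard.trans hm)
  obtain ⟨b, rfl⟩ := t.exists_map_univ_eq hm
  have := MvPolynomial.aeval_psum_eq_of_aeval_esymm_eq (R := R) a b n
    (fun j hj => by
      simpa only [MvPolynomial.aeval_esymm_eq_multiset_esymm] using h j hj) k hk
  simp only [MvPolynomial.psum, map_sum, map_pow, MvPolynomial.aeval_X] at this
  rwa [Multiset.map_map, Multiset.map_map]

/-- The power sums of the roots of `f - t` of exponent less than the degree of `f` do not depend
on `t`. -/
theorem Polynomial.Monic.sum_map_pow_roots_sub_C {K : Type*} [Field K] [IsAlgClosed K] {f : K[X]}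
    (hf : f.Monic) (t : K) {k : ℕ} (hk : k < f.natDegree) :
    ((f - C t).roots.map fun z => z ^ k).sum = (f.roots.map fun z => z ^ k).sum := by
  have hmonic : (f - C t).Monic :=
    hf.sub_of_left (degree_C_le.trans_lt (natDegree_pos_iff_degree_pos.mp (by omega)))
  have hc (p : K[X]) : p.roots.card = p.natDegree := splits_iff_card_roots.mp (IsAlgClosed.splits p)
  refine Multiset.sum_map_pow_eq_of_esymm_eq (by rw [hc, hc, natDegree_sub_C])
    k (fun j hj => ?_) k le_rfl
  have h₁ := coeff_eq_esymm_roots_of_card (hc (f - C t)) (k := f.natDegree - j) (by simp)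
  have h₂ := coeff_eq_esymm_roots_of_card (hc f) (k := f.natDegree - j) (by simp)
  rw [coeff_sub, coeff_C_of_ne_zero (by omega), sub_zero, h₂, natDegree_sub_C, hmonic.leadingCoeff,
    hf.leadingCoeff, Nat.sub_sub_self (by omega)] at h₁
  simpa using h₁.symm

/-- Newton–Girard criterion: for monic `f` of degree `m ≥ 1` and
`g(X) = ∑_{k<m} X^k gₖ(f(X))`, the sum of `g` over every fiber of `f` (with multiplicity)
vanishes iff `∑_{k<m} sₖ • gₖ = 0` in `ℂ[X]`, where `sₖ` is the `k`-th power sum of the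
roots of `f`. -/
theorem stmt_2 (m : ℕ) (hm : 1 ≤ m) (f : Polynomial ℂ) (hf : f.Monic)
    (hdeg : f.natDegree = m) (g₀ : ℕ → Polynomial ℂ) (g : Polynomial ℂ)
    (hg : g = ∑ k ∈ Finset.range m, Polynomial.X ^ k * (g₀ k).comp f) :
    (∀ t : ℂ, (((f - Polynomial.C t).roots).map (fun z => g.eval z)).sum = 0) ↔
      ∑ k ∈ Finset.range m,
        Polynomial.C (((f.roots).map (fun z => z ^ k)).sum) * g₀ k = 0 := by
  have key (t : ℂ) : ((f - C t).roots.map fun z => g.eval z).sum =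
      (∑ k ∈ Finset.range m, C ((f.roots.map fun z => z ^ k).sum) * g₀ k).eval t := by
    have hfiber : ∀ z ∈ (f - C t).roots,
        g.eval z = ∑ k ∈ Finset.range m, z ^ k * (g₀ k).eval t := by
      intro z hz
      have hz' : f.eval z = t := by
        simpa [sub_eq_zero] using isRoot_of_mem_roots hz
      simp [hg, eval_finsetSum, hz']
    rw [Multiset.map_congr rfl hfiber, Multiset.sum_map_sum, eval_finsetSum]
    refine Finset.sum_congr rfl fun k hk => ?_
    rw [Multiset.sum_map_mul_right,
      hf.sum_map_pow_roots_sub_C t (by rw [hdeg]; exact Finset.mem_range.mp hk), eval_mul, eval_C]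
  simp only [key]
  exact ⟨fun h => funext fun t => by simpa using h t, fun h t => by simp [h]⟩
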